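/- Let n ≥ 3 and in the symmetric group Sₙ on {1, 2, …, n} define xᵢ = (1 2)((i+1)(i+2)) for 1 ≤ i ≤ n−2, where (a b) denotes the transposition of a and b. For j > i ≥ 2 define x_{ji} = xⱼx_{j−1}⋯xᵢ, set x_{jj} = xⱼ, and for ε = ±1 define x_{j1ε} = xⱼx_{j−1}⋯x₂x₁^{ε}. For each i with 1 ≤ i ≤ n−2, let Tᵢ = {1} ∪ {x_{ij} : 2 ≤ j ≤ i} ∪ {x_{i1,+1}, x_{i1,−1}} (a set of i+2 elements). Then every element w of the alternating group Aₙ has a unique representation w = w₁w₂⋯w_{n−2} with wᵢ ∈ Tᵢ for each i; that is, the map (w₁, …, w_{n−2}) ↦ w₁w₂⋯w_{n−2} from T₁ × T₂ × ⋯ × T_{n−2} to Aₙ is a bijection. -/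

import Mathlib

/-- `permX n i` is the permutation `(1 2)((i+1)(i+2))` of `{1, …, n}`, written as a
permutation of `Fin n` (so the points `1, 2` of `{1,…,n}` are `⟨0,_⟩, ⟨1,_⟩ : Fin n` and
the points `i+1, i+2` are `⟨i,_⟩, ⟨i+1,_⟩`). Junk value `1` if `i+1 ≥ n`. -/
def permX (n i : ℕ) : Equiv.Perm (Fin n) :=
  if h : i + 1 < n then
    Equiv.swap ⟨0, by omega⟩ ⟨1, by omega⟩ * Equiv.swap ⟨i, by omega⟩ ⟨i + 1, h⟩
  else 1

/-- `permXji n j i = xⱼ x_{j-1} ⋯ xᵢ` (indices descending); `permXji n j j = xⱼ`. -/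
def permXji (n j i : ℕ) : Equiv.Perm (Fin n) :=
  (((List.range' i (j + 1 - i)).reverse).map (permX n)).prod

/-- `permXj1 n j ε = xⱼ x_{j-1} ⋯ x₂ x₁^ε`. -/
def permXj1 (n j : ℕ) (ε : ℤ) : Equiv.Perm (Fin n) :=
  permXji n j 2 * (permX n 1) ^ ε

/-- `permT n i = Tᵢ = {1} ∪ {x_{ij} : 2 ≤ j ≤ i} ∪ {x_{i1,+1}, x_{i1,−1}}`. -/
def permT (n i : ℕ) : Set (Equiv.Perm (Fin n)) :=
  {1} ∪ {p | ∃ j, 2 ≤ j ∧ j ≤ i ∧ p = permXji n i j} ∪ {permXj1 n i 1, permXj1 n i (-1)}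

theorem permX_sign (n i : ℕ) (hi : 1 ≤ i) : Equiv.Perm.sign (permX n i) = 1 := by
  unfold permX
  split_ifs with h
  · rw [Equiv.Perm.sign_mul, Equiv.Perm.sign_swap, Equiv.Perm.sign_swap]
    · rfl
    · simp [Fin.ext_iff]
    · simp [Fin.ext_iff]
  · simp

theorem permX_fix (n i : ℕ) (hi : 1 ≤ i) (k : Fin n) (hk : i + 1 < k.1) : permX n i k = k := by
  unfold permX
  split_ifs with h
  · rw [Equiv.Perm.mul_apply, Equiv.swap_apply_of_ne_of_ne (a := (⟨i, by omega⟩ : Fin n)),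
      Equiv.swap_apply_of_ne_of_ne] <;> (rw [Ne, Fin.ext_iff]; simp only; omega)
  · simp

theorem permX_step (n i : ℕ) (hi : 2 ≤ i) (h : i + 1 < n) :
    permX n i ⟨i, by omega⟩ = ⟨i + 1, h⟩ := by
  unfold permX
  rw [dif_pos h, Equiv.Perm.mul_apply, Equiv.swap_apply_left,
      Equiv.swap_apply_of_ne_of_ne] <;> (rw [Ne, Fin.ext_iff]; simp only; omega)

theorem permX_one_one (n : ℕ) (h : 2 < n) :
    permX n 1 ⟨1, by omega⟩ = ⟨2, h⟩ := by
  unfold permX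
  rw [dif_pos (by omega), Equiv.Perm.mul_apply, Equiv.swap_apply_left,
      Equiv.swap_apply_of_ne_of_ne] <;> (rw [Ne, Fin.ext_iff]; simp only; omega)

theorem permX_one_two (n : ℕ) (h : 2 < n) :
    permX n 1 ⟨2, h⟩ = ⟨0, by omega⟩ := by
  unfold permX
  rw [dif_pos (by omega), Equiv.Perm.mul_apply, Equiv.swap_apply_right,
      Equiv.swap_apply_right]

theorem permXji_succ (n i j : ℕ) (h : j ≤ i + 1) :
    permXji n (i + 1) j = permX n (i + 1) * permXji n i j := by
  unfold permXji
  have e : i + 1 + 1 - j = (i + 1 - j) + 1 := by omega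
  rw [e, List.range'_concat]
  have e2 : j + 1 * (i + 1 - j) = i + 1 := by omega
  simp only [e2, List.reverse_append, List.map_append, List.prod_append]
  simp

theorem permXji_empty (n i : ℕ) : permXji n i (i + 1) = 1 := by
  simp [permXji]

theorem permXji_props (n j : ℕ) (hj : 2 ≤ j) (i : ℕ) (hi : j ≤ i + 1) (hn : i + 1 < n) :
    Equiv.Perm.sign (permXji n i j) = 1 ∧ (∀ k : Fin n, i + 1 < k.1 → permXji n i j k = k) ∧
      permXji n i j ⟨j, by omega⟩ = ⟨i + 1, hn⟩ := by
  induction i with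
  | zero => omega
  | succ i ih =>
    rcases Nat.eq_or_lt_of_le hi with h | h
    · subst h
      rw [permXji_empty]
      simp
    · obtain ⟨h1, h2, h3⟩ := ih (by omega) (by omega)
      rw [permXji_succ n i j (by omega)]
      refine ⟨?_, ?_, ?_⟩
      · rw [Equiv.Perm.sign_mul, h1, permX_sign n _ (by omega), one_mul]
      · intro k hk
        rw [Equiv.Perm.mul_apply, h2 k (by omega), permX_fix n _ (by omega) k hk]
      · rw [Equiv.Perm.mul_apply, h3, permX_step n (i + 1) (by omega)]

/-- The element of `Tᵢ` sending `c` to `i + 1`. -/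
def permF (n i : ℕ) (c : ℕ) : Equiv.Perm (Fin n) :=
  if c = 0 then permXj1 n i (-1) else if c = 1 then permXj1 n i 1 else permXji n i c

theorem mem_permT_iff (n i : ℕ) (t : Equiv.Perm (Fin n)) (hi : 1 ≤ i) :
    t ∈ permT n i ↔ ∃ c, c ≤ i + 1 ∧ t = permF n i c := by
  constructor
  · rintro ((h | ⟨j, h1, h2, rfl⟩) | (h | h))
    · refine ⟨i + 1, le_rfl, ?_⟩
      rw [permF, if_neg (by omega), if_neg (by omega), permXji_empty]; exact h
    · refine ⟨j, by omega, ?_⟩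
      rw [permF, if_neg (by omega), if_neg (by omega)]
    · exact ⟨1, by omega, by rw [permF]; simpa using h⟩
    · exact ⟨0, by omega, by rw [permF]; simpa using h⟩
  · rintro ⟨c, hc, rfl⟩
    unfold permF permT
    split_ifs with h0 h1
    · right; right; rfl
    · right; left; rfl
    · left
      rcases Nat.eq_or_lt_of_le hc with h | h
      · left; rw [h, permXji_empty]; rfl
      · right; exact ⟨c, by omega, by omega, rfl⟩

theorem permF_props (n i c : ℕ) (hi : 1 ≤ i) (hn : i + 1 < n) (hc : c ≤ i + 1) :
    Equiv.Perm.sign (permF n i c) = 1 ∧ (∀ k : Fin n, i + 1 < k.1 → permF n i c k = k) ∧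
      permF n i c ⟨c, by omega⟩ = ⟨i + 1, hn⟩ := by
  obtain ⟨h1, h2, h3⟩ := permXji_props n 2 le_rfl i (by omega) hn
  unfold permF
  split_ifs with h0 h01
  · subst h0
    unfold permXj1
    refine ⟨?_, ?_, ?_⟩
    · simp [h1, permX_sign]
    · intro k hk
      have : (permX n 1)⁻¹ k = k := by
        rw [Equiv.Perm.inv_eq_iff_eq, permX_fix n 1 le_rfl k (by omega)]
      simp only [zpow_neg, zpow_one]
      rw [Equiv.Perm.mul_apply, this, h2 k hk]
    · have : (permX n 1)⁻¹ ⟨0, by omega⟩ = ⟨2, by omega⟩ := by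
        rw [Equiv.Perm.inv_eq_iff_eq, permX_one_two]
      simp only [zpow_neg, zpow_one]
      rw [Equiv.Perm.mul_apply, this, h3]
  · subst h01
    unfold permXj1
    refine ⟨?_, ?_, ?_⟩
    · simp [h1, permX_sign]
    · intro k hk
      rw [zpow_one, Equiv.Perm.mul_apply, permX_fix n 1 le_rfl k (by omega), h2 k hk]
    · rw [zpow_one, Equiv.Perm.mul_apply, permX_one_one n (by omega), h3]
  · exact permXji_props n c (by omega) i hc hn

theorem permT_eq (n i : ℕ) (hi : 1 ≤ i) (hn : i + 1 < n) (t t' : Equiv.Perm (Fin n))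
    (ht : t ∈ permT n i) (ht' : t' ∈ permT n i) (h : t⁻¹ ⟨i + 1, hn⟩ = t'⁻¹ ⟨i + 1, hn⟩) :
    t = t' := by
  obtain ⟨c, hc, rfl⟩ := (mem_permT_iff n i t hi).1 ht
  obtain ⟨c', hc', rfl⟩ := (mem_permT_iff n i t' hi).1 ht'
  have e1 := (Equiv.Perm.inv_eq_iff_eq.2 (permF_props n i c hi hn hc).2.2.symm)
  have e2 := (Equiv.Perm.inv_eq_iff_eq.2 (permF_props n i c' hi hn hc').2.2.symm)
  rw [e1, e2, Fin.ext_iff] at h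
  simp only at h
  rw [h]

theorem partialProd_props (n m : ℕ) (hm : m + 2 ≤ n) (w : ℕ → Equiv.Perm (Fin n))
    (hw : ∀ i < m, w i ∈ permT n (i + 1)) :
    Equiv.Perm.sign ((List.range m).map w).prod = 1 ∧
      ∀ k : Fin n, m + 2 ≤ k.1 → ((List.range m).map w).prod k = k := by
  induction m with
  | zero => simp
  | succ m ih =>
    obtain ⟨h1, h2⟩ := ih (by omega) (fun i hi => hw i (by omega))
    obtain ⟨c, hc, e⟩ := (mem_permT_iff n (m + 1) _ (by omega)).1 (hw m (by omega))
    obtain ⟨f1, f2, _⟩ := permF_props n (m + 1) c (by omega) (by omega) hc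
    rw [← e] at f1 f2
    rw [List.range_succ, List.map_append, List.prod_append, List.map_singleton,
      List.prod_singleton]
    refine ⟨by rw [Equiv.Perm.sign_mul, h1, f1, one_mul], fun k hk => ?_⟩
    rw [Equiv.Perm.mul_apply, f2 k (by omega), h2 k (by omega)]

theorem partialProd_inj (n m : ℕ) (hm : m + 2 ≤ n) (w w' : ℕ → Equiv.Perm (Fin n))
    (hw : ∀ i < m, w i ∈ permT n (i + 1)) (hw' : ∀ i < m, w' i ∈ permT n (i + 1))
    (h : ((List.range m).map w).prod = ((List.range m).map w').prod) :
    ∀ i < m, w i = w' i := by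
  induction m with
  | zero => intro i hi; omega
  | succ m ih =>
    have p := (partialProd_props n m (by omega) w (fun i hi => hw i (by omega))).2
      ⟨m + 2, by omega⟩ le_rfl
    have p' := (partialProd_props n m (by omega) w' (fun i hi => hw' i (by omega))).2
      ⟨m + 2, by omega⟩ le_rfl
    simp only [List.range_succ, List.map_append, List.prod_append, List.map_singleton,
      List.prod_singleton] at h
    have key : w m = w' m := by
      refine permT_eq n (m + 1) (by omega) (by omega) _ _ (hw m (by omega)) (hw' m (by omega)) ?_
      have := congrArg (fun g => g⁻¹ (⟨m + 2, by omega⟩ : Fin n)) h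
      simp only [mul_inv_rev, Equiv.Perm.mul_apply] at this
      rwa [Equiv.Perm.inv_eq_iff_eq.2 p.symm, Equiv.Perm.inv_eq_iff_eq.2 p'.symm] at this
    rw [key] at h
    have h' := mul_right_cancel h
    intro i hi
    rcases Nat.lt_succ_iff_lt_or_eq.1 hi with hi | rfl
    · exact ih (by omega) (fun i hi => hw i (by omega)) (fun i hi => hw' i (by omega)) h' i hi
    · exact key

theorem eq_one_of_fix (n : ℕ) (hn : 2 ≤ n) (g : Equiv.Perm (Fin n))
    (hs : Equiv.Perm.sign g = 1) (hg : ∀ k : Fin n, 2 ≤ k.1 → g k = k) : g = 1 := by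
  have hlt : ∀ k : Fin n, k.1 < 2 → (g k).1 < 2 := by
    intro k hk
    by_contra hcon
    have := g.injective (hg (g k) (by omega))
    rw [this] at hcon
    exact hcon hk
  let a : Fin n := ⟨0, by omega⟩
  let b : Fin n := ⟨1, by omega⟩
  have hab : a ≠ b := by simp [a, b, Fin.ext_iff]
  have ha := hlt a (by simp [a])
  have hb := hlt b (by simp [b])
  have hne : (g a).1 ≠ (g b).1 := fun h => hab (g.injective (Fin.ext h))
  by_cases h0 : (g a).1 = 0
  · ext k
    rcases Nat.lt_or_ge k.1 2 with hk | hk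
    · have : k = a ∨ k = b := by
        simp only [a, b, Fin.ext_iff]; omega
      rcases this with rfl | rfl
      · simpa [a] using h0
      · simp only [Equiv.Perm.one_apply]; change (g b).1 = 1; omega
    · rw [hg k hk]; rfl
  · exfalso
    have : g = Equiv.swap a b := by
      ext k
      rcases Nat.lt_or_ge k.1 2 with hk | hk
      · have : k = a ∨ k = b := by
          simp only [a, b, Fin.ext_iff]; omega
        rcases this with rfl | rfl
        · rw [Equiv.swap_apply_left]; change (g a).1 = 1; omega
        · rw [Equiv.swap_apply_right]; change (g b).1 = 0; omega
      · rw [hg k hk, Equiv.swap_apply_of_ne_of_ne] <;>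
          (simp only [a, b, Ne, Fin.ext_iff]; omega)
    rw [this, Equiv.Perm.sign_swap hab] at hs
    exact absurd hs (by decide)

theorem partialProd_surj (n m : ℕ) (hm : m + 2 ≤ n) (g : Equiv.Perm (Fin n))
    (hs : Equiv.Perm.sign g = 1) (hg : ∀ k : Fin n, m + 2 ≤ k.1 → g k = k) :
    ∃ w : ℕ → Equiv.Perm (Fin n), (∀ i < m, w i ∈ permT n (i + 1)) ∧
      ((List.range m).map w).prod = g := by
  induction m generalizing g with
  | zero =>
    refine ⟨fun _ => 1, by simp, ?_⟩
    rw [eq_one_of_fix n (by omega) g hs hg]; simp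
  | succ m ih =>
    let c : Fin n := g⁻¹ ⟨m + 2, by omega⟩
    have hgc : g c = ⟨m + 2, by omega⟩ := by simp [c]
    have hc : c.1 ≤ m + 1 + 1 := by
      by_contra hcon
      have := hg c (by omega)
      rw [hgc] at this
      have := congrArg Fin.val this
      simp only at this
      omega
    obtain ⟨f1, f2, f3⟩ := permF_props n (m + 1) c.1 (by omega) (by omega) hc
    have fm : permF n (m + 1) c.1 ∈ permT n (m + 1) :=
      (mem_permT_iff n (m + 1) _ (by omega)).2 ⟨c.1, hc, rfl⟩
    generalize permF n (m + 1) c.1 = t at *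
    obtain ⟨w, hw, hp⟩ := ih (by omega) (g * t⁻¹) (by simp [hs, f1]) (by
      intro k hk
      rw [Equiv.Perm.mul_apply]
      rcases Nat.eq_or_lt_of_le hk with h | h
      · have hk' : k = ⟨m + 1 + 1, by omega⟩ := Fin.ext h.symm
        rw [hk', Equiv.Perm.inv_eq_iff_eq.2 f3.symm]
        exact hgc
      · rw [Equiv.Perm.inv_eq_iff_eq.2 (f2 k (by omega)).symm, hg k (by omega)])
    refine ⟨Function.update w m t, ?_, ?_⟩
    · intro i hi
      rcases Nat.lt_succ_iff_lt_or_eq.1 hi with hi | rfl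
      · rw [Function.update_of_ne (by omega)]; exact hw i hi
      · rw [Function.update_self]; exact fm
    · rw [List.range_succ, List.map_append, List.prod_append, List.map_singleton,
        List.prod_singleton, Function.update_self]
      have : (List.range m).map (Function.update w m t) = (List.range m).map w := by
        apply List.map_congr_left
        intro i hi
        rw [Function.update_of_ne]
        have := List.mem_range.1 hi
        omega
      rw [this, hp, inv_mul_cancel_right]

theorem ofFn_eq_range {α : Type*} (m : ℕ) (f : ℕ → α) :
    List.ofFn (fun i : Fin m => f i.1) = (List.range m).map f := by
  apply List.ext_getElem <;> simp

theorem exists_ext (n : ℕ) (w : (i : Fin (n - 2)) → (permT n (i.1 + 1))) :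
    ∃ v : ℕ → Equiv.Perm (Fin n), (∀ i : Fin (n - 2), v i.1 = w i) ∧
      (∀ i < n - 2, v i ∈ permT n (i + 1)) ∧
      (List.ofFn (fun i => (w i : Equiv.Perm (Fin n)))).prod
        = ((List.range (n - 2)).map v).prod := by
  let v : ℕ → Equiv.Perm (Fin n) := fun i => if h : i < n - 2 then (w ⟨i, h⟩).1 else 1
  have hv : ∀ i : Fin (n - 2), v i.1 = w i := fun i => by simp [v]
  refine ⟨v, hv, ?_, ?_⟩
  · intro i hi
    rw [hv ⟨i, hi⟩]
    exact (w ⟨i, hi⟩).2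
  · rw [← ofFn_eq_range]
    simp only [hv]


theorem stmt_12 (n : ℕ) (hn : 3 ≤ n) :
    Function.Injective
        (fun w : (i : Fin (n - 2)) → (permT n (i.1 + 1)) =>
          (List.ofFn (fun i => (w i : Equiv.Perm (Fin n)))).prod) ∧
      Set.range
          (fun w : (i : Fin (n - 2)) → (permT n (i.1 + 1)) =>
            (List.ofFn (fun i => (w i : Equiv.Perm (Fin n)))).prod)
        = (alternatingGroup (Fin n) : Set (Equiv.Perm (Fin n))) := by
  constructor
  · intro w w' h
    obtain ⟨v, hv, hm, e⟩ := exists_ext n w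
    obtain ⟨v', hv', hm', e'⟩ := exists_ext n w'
    simp only at h
    rw [e, e'] at h
    have := partialProd_inj n (n - 2) (by omega) v v' hm hm' h
    funext i
    apply Subtype.ext
    rw [← hv, ← hv', this i.1 i.2]
  · ext g
    simp only [Set.mem_range, SetLike.mem_coe, Equiv.Perm.mem_alternatingGroup]
    constructor
    · rintro ⟨w, rfl⟩
      obtain ⟨v, hv, hm, e⟩ := exists_ext n w
      rw [e]
      exact (partialProd_props n (n - 2) (by omega) v hm).1
    · intro hg
      obtain ⟨v, hm, e⟩ := partialProd_surj n (n - 2) (by omega) g hg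
        (fun k hk => absurd k.2 (by omega))
      refine ⟨fun i => ⟨v i.1, hm i.1 i.2⟩, ?_⟩
      rw [← e, ← ofFn_eq_range]
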